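/- For every H ∈ (1/2,1) there exists a constant c_H > 0, depending only on H, such that for all α ∈ (1/2,1) and all ϱ > 0, ∫₀^∞ ∫₀^∞ s^(α−1)·r^(α−1)·e^(−ϱs)·e^(−ϱr)·|r−s|^(2H−2) ds dr = c_H · Γ(α)² · ∫_ℝ |ξ|^(1−2H)·(ϱ² + ξ²)^(−α) dξ. -/

import Mathlib

open MeasureTheory Filter Topology

lemma aux_even (f : ℝ → ENNReal) (hf : ∀ x, f (-x) = f x) :
    ∫⁻ x, f x = 2 * ∫⁻ x in Set.Ioi (0:ℝ), f x := by
  have h := lintegral_image_eq_lintegral_abs_deriv_mul (s := Set.Ioi (0:ℝ)) (f := fun x => -x)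
    (f' := fun _ => -1) measurableSet_Ioi (fun x _ => (hasDerivAt_neg x).hasDerivWithinAt)
    (neg_injective.injOn) f
  simp only [Set.image_neg_eq_neg, Set.neg_Ioi, neg_zero, abs_neg, abs_one, ENNReal.ofReal_one,
    one_mul, hf] at h
  rw [← lintegral_add_compl f measurableSet_Ioi (A := Set.Ioi (0:ℝ)), Set.compl_Ioi,
    setLIntegral_congr Iio_ae_eq_Iic.symm, h, two_mul]

lemma aux_gamma {a c : ℝ} (ha : 0 < a) (hc : 0 < c) :
    ∫⁻ u in Set.Ioi (0:ℝ), ENNReal.ofReal (u ^ (a - 1) * Real.exp (-(c * u)))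
      = ENNReal.ofReal (c ^ (-a) * Real.Gamma a) := by
  have h := Real.integral_rpow_mul_exp_neg_mul_Ioi ha hc
  have hpos : 0 < (1 / c) ^ a * Real.Gamma a :=
    mul_pos (by positivity) (Real.Gamma_pos_of_pos ha)
  have hi : Integrable (fun t : ℝ => t ^ (a - 1) * Real.exp (-(c * t)))
      (volume.restrict (Set.Ioi 0)) := by
    by_contra hn
    rw [integral_undef hn] at h
    exact hpos.ne h
  rw [← ofReal_integral_eq_lintegral_ofReal hi, h]
  · rw [one_div, Real.inv_rpow hc.le, Real.rpow_neg hc.le]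
  · filter_upwards [ae_restrict_mem measurableSet_Ioi] with t ht
    have : (0:ℝ) < t := ht
    simp only [Pi.zero_apply]; positivity

lemma aux_beta {a b : ℝ} (ha : 0 < a) (hb : 0 < b) :
    ∫⁻ x in Set.Ioo (0:ℝ) 1, ENNReal.ofReal (x ^ (a - 1) * (1 - x) ^ (b - 1))
      = ENNReal.ofReal (ProbabilityTheory.beta a b) := by
  have h := ProbabilityTheory.lintegral_betaPDF_eq_one ha hb
  have hB := ProbabilityTheory.beta_pos ha hb
  rw [ProbabilityTheory.lintegral_betaPDF] at h
  have : ∀ x : ℝ, ENNReal.ofReal (1 / ProbabilityTheory.beta a b * x ^ (a - 1) * (1 - x) ^ (b - 1))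
    = ENNReal.ofReal (1 / ProbabilityTheory.beta a b) *
      ENNReal.ofReal (x ^ (a - 1) * (1 - x) ^ (b - 1)) := fun x => by
    rw [mul_assoc, ENNReal.ofReal_mul (by positivity)]
  simp_rw [this] at h
  rw [lintegral_const_mul _ (by fun_prop)] at h
  calc _ = ENNReal.ofReal (ProbabilityTheory.beta a b) * (ENNReal.ofReal (1 / ProbabilityTheory.beta a b) * ∫⁻ x in Set.Ioo (0:ℝ) 1, ENNReal.ofReal (x ^ (a - 1) * (1 - x) ^ (b - 1))) := by
        rw [← mul_assoc, ← ENNReal.ofReal_mul hB.le, mul_one_div_cancel hB.ne']; simp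
    _ = _ := by rw [h, mul_one]

lemma aux_sq (g : ℝ → ENNReal) (s t : Set ℝ) (hs : MeasurableSet s) (hs0 : s ⊆ Set.Ioi 0)
    (hst : (fun y : ℝ => y ^ 2) '' s = t) :
    ∫⁻ w in t, g w = ∫⁻ y in s, ENNReal.ofReal (2 * y) * g (y ^ 2) := by
  have h := lintegral_image_eq_lintegral_abs_deriv_mul (s := s) (f := fun y => y ^ 2)
    (f' := fun y => 2 * y) hs
    (fun x _ => by simpa using (hasDerivAt_pow 2 x).hasDerivWithinAt)
    (fun x hx y hy h => by
      have h1 : (0:ℝ) < x := hs0 hx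
      have h2 : (0:ℝ) < y := hs0 hy
      exact (pow_left_inj₀ h1.le h2.le two_ne_zero).1 h) g
  rw [← hst, h]
  refine setLIntegral_congr_fun hs fun y hy => ?_
  have h1 : (0:ℝ) < y := hs0 hy
  simp only [abs_of_pos (show 0 < 2 * y by linarith)]

lemma aux_scale (g : ℝ → ENNReal) {s : ℝ} (hs : 0 < s) :
    ∫⁻ r in Set.Ioi (0:ℝ), g r = ∫⁻ x in Set.Ioi (0:ℝ), ENNReal.ofReal s * g (s * x) := by
  have h := lintegral_image_eq_lintegral_abs_deriv_mul (s := Set.Ioi (0:ℝ)) (f := fun y => s * y)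
    (f' := fun y => s) measurableSet_Ioi
    (fun x _ => by simpa using ((hasDerivAt_id x).const_mul s).hasDerivWithinAt)
    (fun x hx y hy h => by simpa [hs.ne'] using h) g
  rw [abs_of_pos hs] at h
  rw [← h]
  congr 2
  ext x
  simp only [Set.mem_image, Set.mem_Ioi]
  constructor
  · intro hx
    exact ⟨x / s, by positivity, by field_simp⟩
  · rintro ⟨y, hy, rfl⟩; positivity

lemma aux_mob (g : ℝ → ENNReal) :
    ∫⁻ r in Set.Ioi (0:ℝ), g r =
      ∫⁻ y in Set.Ioo (-1:ℝ) 1, ENNReal.ofReal (2 / (1 - y) ^ 2) * g ((1 + y) / (1 - y)) := by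
  have h := lintegral_image_eq_lintegral_abs_deriv_mul (s := Set.Ioo (-1:ℝ) 1)
    (f := fun y => (1 + y) / (1 - y))
    (f' := fun y => 2 / (1 - y) ^ 2) measurableSet_Ioo
    (fun x hx => by
      have h1 : 1 - x ≠ 0 := by linarith [hx.2]
      have := (((hasDerivAt_id x).const_add 1).div ((hasDerivAt_id x).const_sub 1) h1)
      refine (this.congr_deriv ?_).hasDerivWithinAt
      simp only [id]
      congr 1; ring)
    (fun x hx y hy h => by
      have h1 : 1 - x ≠ 0 := by linarith [hx.2]
      have h2 : 1 - y ≠ 0 := by linarith [hy.2]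
      simp only at h
      rw [div_eq_div_iff h1 h2] at h
      linarith) g
  simp only [abs_of_nonneg (show (0:ℝ) ≤ 2 / (1 - _) ^ 2 by positivity)] at h
  rw [← h]
  congr 2
  ext x
  simp only [Set.mem_image, Set.mem_Ioi, Set.mem_Ioo]
  constructor
  · intro hx
    refine ⟨(x - 1) / (x + 1), ⟨?_, ?_⟩, ?_⟩
    · rw [lt_div_iff₀ (by positivity)]; linarith
    · rw [div_lt_iff₀ (by positivity)]; linarith
    · field_simp; ring
  · rintro ⟨y, hy, rfl⟩
    exact div_pos (by linarith) (by linarith)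

/-- RHS -/
lemma aux_rhs {H α ϱ : ℝ} (hH : H ∈ Set.Ioo (1 / 2 : ℝ) 1) (hα : α ∈ Set.Ioo (1 / 2 : ℝ) 1)
    (hϱ : 0 < ϱ) :
    ENNReal.ofReal (Real.Gamma α) *
      ∫⁻ ξ : ℝ, ENNReal.ofReal (|ξ| ^ (1 - 2 * H) * (ϱ ^ 2 + ξ ^ 2) ^ (-α)) =
    ENNReal.ofReal (Real.Gamma (1 - H) * ((ϱ ^ 2) ^ (-(α + H - 1)) * Real.Gamma (α + H - 1))) := by
  obtain ⟨hH1, hH2⟩ := hH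
  obtain ⟨ha1, ha2⟩ := hα
  have hG : 0 < Real.Gamma α := Real.Gamma_pos_of_pos (by linarith)
  have hG1 : 0 < Real.Gamma (1 - H) := Real.Gamma_pos_of_pos (by linarith)
  rw [← lintegral_const_mul _ (by fun_prop)]
  have e1 : ∀ ξ : ℝ, ENNReal.ofReal (Real.Gamma α) *
      ENNReal.ofReal (|ξ| ^ (1 - 2 * H) * (ϱ ^ 2 + ξ ^ 2) ^ (-α)) =
      ∫⁻ u in Set.Ioi (0:ℝ), ENNReal.ofReal (|ξ| ^ (1 - 2 * H)) *
        ENNReal.ofReal (u ^ (α - 1) * Real.exp (-((ϱ ^ 2 + ξ ^ 2) * u))) := by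
    intro ξ
    rw [lintegral_const_mul _ (by fun_prop), aux_gamma (by linarith) (by positivity),
      ← ENNReal.ofReal_mul hG.le, ← ENNReal.ofReal_mul (by positivity)]
    congr 1; ring
  simp_rw [e1]
  rw [lintegral_lintegral_swap (by fun_prop)]
  have e2 : ∀ u ∈ Set.Ioi (0:ℝ), ∫⁻ ξ : ℝ, ENNReal.ofReal (|ξ| ^ (1 - 2 * H)) *
        ENNReal.ofReal (u ^ (α - 1) * Real.exp (-((ϱ ^ 2 + ξ ^ 2) * u))) =
      ENNReal.ofReal (Real.Gamma (1 - H)) *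
       ENNReal.ofReal (u ^ (α + H - 1 - 1) * Real.exp (-(ϱ ^ 2 * u))) := by
    intro u hu
    have hu : 0 < u := hu
    rw [aux_even _ (fun x => by simp)]
    rw [← lintegral_const_mul _ (by fun_prop)]
    have h3 := aux_gamma (a := 1 - H) (c := u) (by linarith) hu
    rw [aux_sq _ (Set.Ioi 0) (Set.Ioi 0) measurableSet_Ioi (le_refl _) (by
      ext x
      simp only [Set.mem_image, Set.mem_Ioi]
      constructor
      · rintro ⟨y, hy, rfl⟩; positivity
      · intro hx; exact ⟨√x, by positivity, Real.sq_sqrt hx.le⟩)] at h3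
    calc _ = ∫⁻ y in Set.Ioi (0:ℝ), ENNReal.ofReal (u ^ (α - 1) * Real.exp (-(ϱ ^ 2 * u))) *
          (ENNReal.ofReal (2 * y) * ENNReal.ofReal ((y ^ 2) ^ (1 - H - 1) * Real.exp (-(u * y ^ 2)))) := by
          refine setLIntegral_congr_fun measurableSet_Ioi fun y hy => ?_
          have hy : 0 < y := hy
          rw [show (2:ENNReal) = ENNReal.ofReal 2 by simp]
          simp only [abs_of_pos hy]
          repeat rw [← ENNReal.ofReal_mul (by positivity)]
          congr 1
          have k1 : y ^ (1 - 2 * H) = y * (y ^ 2) ^ (1 - H - 1) := by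
            rw [← Real.rpow_natCast, ← Real.rpow_mul hy.le]
            nth_rw 2 [← Real.rpow_one y]
            rw [← Real.rpow_add hy]; congr 1; push_cast; ring
          have k2 : Real.exp (-((ϱ ^ 2 + y ^ 2) * u)) = Real.exp (-(ϱ ^ 2 * u)) * Real.exp (-(u * y ^ 2)) := by
            rw [← Real.exp_add]; congr 1; ring
          rw [k1, k2]; ring
      _ = _ := by
        rw [lintegral_const_mul _ (by fun_prop), h3, ← ENNReal.ofReal_mul (by positivity), ← ENNReal.ofReal_mul (by positivity)]
        congr 1
        have : u ^ (α + H - 1 - 1) = u ^ (α - 1) * u ^ (-(1 - H)) := by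
          rw [← Real.rpow_add hu]; congr 1; ring
        rw [this]; ring
  rw [setLIntegral_congr_fun measurableSet_Ioi e2, lintegral_const_mul _ (by fun_prop),
    aux_gamma (by linarith) (by positivity), ← ENNReal.ofReal_mul hG1.le]

lemma aux_B {H α : ℝ} (hH : H ∈ Set.Ioo (1 / 2 : ℝ) 1) (hα : α ∈ Set.Ioo (1 / 2 : ℝ) 1) :
    ∫⁻ x in Set.Ioi (0:ℝ), ENNReal.ofReal
      (x ^ (α - 1) * |x - 1| ^ (2 * H - 2) * (1 + x) ^ (-(2 * (α + H - 1)))) =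
    ENNReal.ofReal (2 ^ (1 - 2 * α) * ProbabilityTheory.beta (H - 1 / 2) α) := by
  obtain ⟨hH1, hH2⟩ := hH
  obtain ⟨ha1, ha2⟩ := hα
  rw [aux_mob]
  set f : ℝ → ENNReal := (Set.Ioo (-1:ℝ) 1).indicator (fun y => ENNReal.ofReal
    (2 ^ (1 - 2 * α) * ((1 - y ^ 2) ^ (α - 1) * |y| ^ (2 * H - 2)))) with hf
  have hfe : ∀ x, f (-x) = f x := by
    intro x
    simp only [hf, Set.indicator, Set.mem_Ioo, even_two, Even.neg_pow, abs_neg]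
    congr 1
    apply propext; constructor <;> rintro ⟨h1, h2⟩ <;> constructor <;> linarith
  calc _ = ∫⁻ y, f y := by
        rw [hf, lintegral_indicator measurableSet_Ioo]
        refine setLIntegral_congr_fun measurableSet_Ioo fun y hy => ?_
        have h1 : 0 < 1 - y := by linarith [hy.2]
        have h2 : 0 < 1 + y := by linarith [hy.1]
        rw [← ENNReal.ofReal_mul (by positivity)]
        congr 1
        have k1 : (1 + y) / (1 - y) - 1 = (2 / (1 - y)) * y := by field_simp; ring
        have k2 : 1 + (1 + y) / (1 - y) = 2 / (1 - y) := by field_simp; ring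
        have k3 : 1 - y ^ 2 = (1 - y) * (1 + y) := by ring
        rw [k1, k2, k3, abs_mul, Real.mul_rpow (abs_nonneg _) (abs_nonneg _),
          abs_of_pos (show 0 < 2 / (1 - y) by positivity)]
        have k4 : 2 / (1 - y) ^ 2 = Real.exp (Real.log 2 - 2 * Real.log (1 - y)) := by
          rw [Real.exp_sub, Real.exp_log (by norm_num), two_mul, Real.exp_add, Real.exp_log h1, sq]
        rw [k4, Real.rpow_def_of_pos (show 0 < (1 + y) / (1 - y) by positivity),
          Real.rpow_def_of_pos (show 0 < 2 / (1 - y) by positivity),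
          Real.rpow_def_of_pos (show 0 < 2 / (1 - y) by positivity),
          Real.rpow_def_of_pos (show (0:ℝ) < 2 by positivity),
          Real.rpow_def_of_pos (show 0 < (1 - y) * (1 + y) by positivity),
          Real.log_div h2.ne' h1.ne', Real.log_div two_ne_zero h1.ne', Real.log_mul h1.ne' h2.ne']
        generalize |y| ^ (2 * H - 2) = P
        generalize Real.log (1 - y) = a
        generalize Real.log (1 + y) = b
        generalize Real.log 2 = c
        rw [← mul_assoc, ← mul_assoc, ← mul_assoc, ← mul_assoc, mul_right_comm _ P,
          ← Real.exp_add, ← Real.exp_add, ← Real.exp_add, ← Real.exp_add]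
        congr 2
        ring
    _ = 2 * ∫⁻ y in Set.Ioo (0:ℝ) 1, ENNReal.ofReal
          (2 ^ (1 - 2 * α) * ((1 - y ^ 2) ^ (α - 1) * |y| ^ (2 * H - 2))) := by
        rw [aux_even f hfe, hf, setLIntegral_indicator measurableSet_Ioo]
        congr 3
        ext x; simp only [Set.mem_inter_iff, Set.mem_Ioo, Set.mem_Ioi]
        constructor
        · rintro ⟨⟨h1, h2⟩, h3⟩; exact ⟨h3, h2⟩
        · rintro ⟨h1, h2⟩; exact ⟨⟨by linarith, h2⟩, h1⟩
    _ = _ := by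
        rw [← lintegral_const_mul _ (by fun_prop)]
        have h3 := aux_beta (a := H - 1 / 2) (b := α) (by linarith) (by linarith)
        rw [aux_sq _ (Set.Ioo 0 1) (Set.Ioo 0 1) measurableSet_Ioo (fun x hx => hx.1) (by
          ext x
          simp only [Set.mem_image, Set.mem_Ioo]
          constructor
          · rintro ⟨y, ⟨hy, hy1⟩, rfl⟩; exact ⟨by positivity, by nlinarith⟩
          · rintro ⟨hx, hx1⟩
            exact ⟨√x, ⟨by positivity, by rw [Real.sqrt_lt' one_pos]; simpa using hx1⟩, Real.sq_sqrt hx.le⟩)] at h3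
        rw [ENNReal.ofReal_mul (by positivity), ← h3, ← lintegral_const_mul _ (by fun_prop)]
        refine setLIntegral_congr_fun measurableSet_Ioo fun y hy => ?_
        have h1 : 0 < y := hy.1
        have h2 : 0 < 1 - y ^ 2 := by nlinarith [hy.1, hy.2]
        simp only [abs_of_pos h1]
        rw [show (2:ENNReal) = ENNReal.ofReal 2 by simp]
        repeat rw [← ENNReal.ofReal_mul (by positivity)]
        congr 1
        have k1 : y ^ (2 * H - 2) = y * (y ^ 2) ^ (H - 1 / 2 - 1) := by
          rw [← Real.rpow_natCast, ← Real.rpow_mul h1.le]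
          nth_rw 2 [← Real.rpow_one y]
          rw [← Real.rpow_add h1]; congr 1; push_cast; ring
        rw [k1]; ring

lemma aux_lhs {H α ϱ : ℝ} (hH : H ∈ Set.Ioo (1 / 2 : ℝ) 1) (hα : α ∈ Set.Ioo (1 / 2 : ℝ) 1)
    (hϱ : 0 < ϱ) :
    (∫⁻ s in Set.Ioi (0 : ℝ), ∫⁻ r in Set.Ioi (0 : ℝ),
          ENNReal.ofReal
            (s ^ (α - 1) * r ^ (α - 1) * Real.exp (-ϱ * s) * Real.exp (-ϱ * r) *
              |r - s| ^ (2 * H - 2))) =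
    ENNReal.ofReal (Real.Gamma (2 * (α + H - 1)) * ϱ ^ (-(2 * (α + H - 1))) *
      (2 ^ (1 - 2 * α) * ProbabilityTheory.beta (H - 1 / 2) α)) := by
  have hB := aux_B hH hα
  obtain ⟨hH1, hH2⟩ := hH
  obtain ⟨ha1, ha2⟩ := hα
  have hG : 0 < Real.Gamma (2 * (α + H - 1)) := Real.Gamma_pos_of_pos (by linarith)
  have e1 : ∀ s ∈ Set.Ioi (0:ℝ), ∫⁻ r in Set.Ioi (0 : ℝ),
          ENNReal.ofReal
            (s ^ (α - 1) * r ^ (α - 1) * Real.exp (-ϱ * s) * Real.exp (-ϱ * r) *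
              |r - s| ^ (2 * H - 2)) =
      ∫⁻ x in Set.Ioi (0 : ℝ), ENNReal.ofReal (x ^ (α - 1) * |x - 1| ^ (2 * H - 2)) *
        ENNReal.ofReal (s ^ (2 * (α + H - 1) - 1) * Real.exp (-((ϱ * (1 + x)) * s))) := by
    intro s hs
    have hs : 0 < s := hs
    rw [aux_scale _ hs]
    refine setLIntegral_congr_fun measurableSet_Ioi fun x hx => ?_
    have hx : 0 < x := hx
    repeat rw [← ENNReal.ofReal_mul (by positivity)]
    congr 1
    have k1 : s * x - s = s * (x - 1) := by ring
    have k2 : Real.exp (-((ϱ * (1 + x)) * s)) = Real.exp (-ϱ * s) * Real.exp (-ϱ * (s * x)) := by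
      rw [← Real.exp_add]; congr 1; ring
    have k3 : s ^ (2 * (α + H - 1) - 1) = s * s ^ (α - 1) * s ^ (α - 1) * s ^ (2 * H - 2) := by
      nth_rw 2 [← Real.rpow_one s]
      rw [← Real.rpow_add hs, ← Real.rpow_add hs, ← Real.rpow_add hs]; congr 1; ring
    rw [k1, k2, k3, abs_mul, abs_of_pos hs, Real.mul_rpow hs.le hx.le,
      Real.mul_rpow hs.le (abs_nonneg _)]
    ring
  rw [setLIntegral_congr_fun measurableSet_Ioi e1, lintegral_lintegral_swap (by fun_prop),
    ENNReal.ofReal_mul (by positivity), ← hB, ← lintegral_const_mul _ (by fun_prop)]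
  refine setLIntegral_congr_fun measurableSet_Ioi fun x hx => ?_
  have hx : 0 < x := hx
  rw [lintegral_const_mul _ (by fun_prop), aux_gamma (by linarith) (by positivity),
    ← ENNReal.ofReal_mul (by positivity), ← ENNReal.ofReal_mul (by positivity),
    Real.mul_rpow hϱ.le (by positivity)]
  congr 1; ring

theorem parseval_identity_for_M (H : ℝ) (hH : H ∈ Set.Ioo (1 / 2 : ℝ) 1) :
    ∃ cH : ℝ, 0 < cH ∧ ∀ α ϱ : ℝ, α ∈ Set.Ioo (1 / 2 : ℝ) 1 → 0 < ϱ →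
      (∫⁻ s in Set.Ioi (0 : ℝ), ∫⁻ r in Set.Ioi (0 : ℝ),
          ENNReal.ofReal
            (s ^ (α - 1) * r ^ (α - 1) * Real.exp (-ϱ * s) * Real.exp (-ϱ * r) *
              |r - s| ^ (2 * H - 2)))
        = ENNReal.ofReal (cH * Real.Gamma α ^ 2) *
            ∫⁻ ξ : ℝ, ENNReal.ofReal (|ξ| ^ (1 - 2 * H) * (ϱ ^ 2 + ξ ^ 2) ^ (-α)) := by
  have hH' := hH
  obtain ⟨hH1, hH2⟩ := hH'
  have g1 : 0 < Real.Gamma (H - 1 / 2) := Real.Gamma_pos_of_pos (by linarith)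
  have g2 : 0 < Real.Gamma (1 - H) := Real.Gamma_pos_of_pos (by linarith)
  refine ⟨2 ^ (2 * H - 2) * Real.Gamma (H - 1 / 2) / (√Real.pi * Real.Gamma (1 - H)),
    by positivity, fun α ϱ hα hϱ => ?_⟩
  rw [aux_lhs hH hα hϱ]
  have hr := aux_rhs hH hα hϱ
  obtain ⟨ha1, ha2⟩ := hα
  have g3 : 0 < Real.Gamma α := Real.Gamma_pos_of_pos (by linarith)
  have g4 : 0 < Real.Gamma (α + H - 1 + 1 / 2) := Real.Gamma_pos_of_pos (by linarith)
  have g5 : 0 < Real.Gamma (α + H - 1) := Real.Gamma_pos_of_pos (by linarith)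
  rw [show ∀ c : ℝ, c * Real.Gamma α ^ 2 = (c * Real.Gamma α) * Real.Gamma α from
      fun c => by ring,
    ENNReal.ofReal_mul (q := Real.Gamma α) (by positivity), mul_assoc (ENNReal.ofReal _), hr,
    ← ENNReal.ofReal_mul (by positivity)]
  congr 1
  have hd := Real.Gamma_mul_Gamma_add_half (α + H - 1)
  have k1 : (ϱ ^ 2) ^ (-(α + H - 1)) = ϱ ^ (-(2 * (α + H - 1))) := by
    rw [← Real.rpow_natCast, ← Real.rpow_mul hϱ.le]; congr 1; push_cast; ring
  have k2 : (2:ℝ) ^ (1 - 2 * α) = 2 ^ (2 * H - 2) * 2 ^ (1 - 2 * (α + H - 1)) := by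
    rw [← Real.rpow_add two_pos]; congr 1; ring
  rw [ProbabilityTheory.beta, show H - 1 / 2 + α = α + H - 1 + 1 / 2 by ring, k1, k2]
  have hpi : 0 < √Real.pi := by positivity
  generalize Real.Gamma (α + H - 1 + 1 / 2) = A at *
  generalize Real.Gamma (H - 1 / 2) = B at *
  generalize Real.Gamma (2 * (α + H - 1)) = C at *
  generalize Real.Gamma (α + H - 1) = D at *
  generalize Real.Gamma (1 - H) = E at *
  generalize (2:ℝ) ^ (1 - 2 * (α + H - 1)) = F at *
  generalize (2:ℝ) ^ (2 * H - 2) = K at *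
  generalize ϱ ^ (-(2 * (α + H - 1))) = M at *
  generalize Real.Gamma α = N at *
  generalize √Real.pi = P at *
  have e : C * F = D * A / P := by rw [hd]; field_simp
  calc _ = (C * F) * M * K * B * N / A := by ring
    _ = _ := by rw [e]; field_simp
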